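/- Define g_a(z₁,...,z_m) = ∏_{k=1}^m z_k^a e^{−z_k²/2} · Δ(z_m²,...,z₁²). For μ ∈ {0,1}, set m̂ = m+μ and s_m̂ = 0 if μ = 1. Then for s₁ ≥ s₂ ≥ ... ≥ s_m ≥ 0, ∫_{s₁}^{∞} dt₁ ∫_{s₂}^{s₁} dt₂ ⋯ ∫_{s_m̂}^{s_{m̂−1}} dt_m̂ g_{1−μ}(t₁,...,t_m̂) = (π/2)^{μ/2} · g_μ(s₁,...,s_m). -/

import Mathlib

open Finset MeasureTheory

/-- `g_a(z₁,…,z_m) = ∏ z_k^a e^{-z_k²/2} · Δ(z_m²,…,z₁²)`, where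
`Δ(z_m²,…,z₁²) = ∏_{j<k} (z_j² - z_k²)` (indices in original order). -/
noncomputable def gFun (a : ℕ) {m : ℕ} (z : Fin m → ℝ) : ℝ :=
  (∏ k, z k ^ a * Real.exp (-z k ^ 2 / 2)) *
    ∏ k : Fin m, ∏ j ∈ Finset.univ.filter (· < k), (z j ^ 2 - z k ^ 2)


noncomputable def oddF (a j : ℕ) (t : ℝ) : ℝ := t ^ a * Real.exp (-t ^ 2 / 2) * (-t ^ 2) ^ j

noncomputable def oddPhi (a j : ℕ) (x : ℝ) : ℝ := ∫ t in Set.Ioi x, oddF a j t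

lemma oddF_integrable (a j : ℕ) : Integrable (oddF a j) := by
  have h := integrable_rpow_mul_exp_neg_mul_sq (b := 1 / 2) (by norm_num)
    (s := ((a + 2 * j : ℕ) : ℝ)) (by have : (0 : ℝ) ≤ ((a + 2 * j : ℕ) : ℝ) := Nat.cast_nonneg _
                                     linarith)
  have h2 := h.const_mul ((-1) ^ j)
  convert h2 using 1
  funext t
  rw [Real.rpow_natCast, oddF, neg_pow (t ^ 2) j, pow_add, pow_mul,
    show -t ^ 2 / 2 = -(1 / 2) * t ^ 2 by ring]
  ring

lemma oddF_one_hasDerivAt (j : ℕ) (x : ℝ) :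
    HasDerivAt (oddF 1 j) ((2 * j + 1) * oddF 0 j x + oddF 0 (j + 1) x) x := by
  have hx := hasDerivAt_id x
  have hq : HasDerivAt (fun t : ℝ => -t ^ 2) (-(2 * x)) x := by
    exact ((hasDerivAt_pow 2 x).neg).congr_deriv (by simp)
  have he := (hq.div_const 2).exp
  have hp := hq.pow j
  have h := ((hx.pow 1).mul he).mul hp
  refine h.congr_deriv ?_
  simp only [oddF, id]
  rcases j with _ | j
  · simp; ring
  · simp; ring

lemma oddF_zero_hasDerivAt (j : ℕ) (x : ℝ) :
    HasDerivAt (oddF 0 (j + 1)) (-(2 * (j + 1) * oddF 1 j x + oddF 1 (j + 1) x)) x := by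
  have hx := hasDerivAt_id x
  have hq : HasDerivAt (fun t : ℝ => -t ^ 2) (-(2 * x)) x := by
    exact ((hasDerivAt_pow 2 x).neg).congr_deriv (by simp)
  have he := (hq.div_const 2).exp
  have hp := hq.pow (j + 1)
  have h := ((hx.pow 0).mul he).mul hp
  refine h.congr_deriv ?_
  simp only [oddF, id]
  simp; ring

lemma oddF_zero_zero_hasDerivAt (x : ℝ) :
    HasDerivAt (oddF 0 0) (-oddF 1 0 x) x := by
  have hx := hasDerivAt_id x
  have hq : HasDerivAt (fun t : ℝ => -t ^ 2) (-(2 * x)) x := by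
    exact ((hasDerivAt_pow 2 x).neg).congr_deriv (by simp)
  have he := (hq.div_const 2).exp
  have hp := hq.pow 0
  have h := ((hx.pow 0).mul he).mul hp
  refine h.congr_deriv ?_
  simp only [oddF, id]
  simp; ring

lemma odd_ftc (h h' : ℝ → ℝ) (hd : ∀ x, HasDerivAt h (h' x) x) (hi : Integrable h)
    (hi' : Integrable h') (x : ℝ) : ∫ t in Set.Ioi x, h' t = - h x := by
  have ht := tendsto_zero_of_hasDerivAt_of_integrableOn_Ioi (a := x) (fun y _ => hd y)
    hi'.integrableOn hi.integrableOn
  have := integral_Ioi_of_hasDerivAt_of_tendsto' (a := x) (fun y _ => hd y) hi'.integrableOn ht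
  rw [this]; ring

lemma oddPhi_zero_succ (j : ℕ) (x : ℝ) :
    oddPhi 0 (j + 1) x = -oddF 1 j x + (-(2 * j + 1)) * oddPhi 0 j x := by
  have h := odd_ftc _ _ (oddF_one_hasDerivAt j) (oddF_integrable _ _)
    (((oddF_integrable 0 j).const_mul _).add (oddF_integrable 0 (j + 1))) x
  rw [integral_add ((oddF_integrable 0 j).const_mul _).integrableOn
    (oddF_integrable 0 (j + 1)).integrableOn, integral_const_mul] at h
  unfold oddPhi
  linarith

lemma oddPhi_one_succ (j : ℕ) (x : ℝ) :
    oddPhi 1 (j + 1) x = oddF 0 (j + 1) x + (-(2 * (j + 1))) * oddPhi 1 j x := by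
  have h := odd_ftc _ _ (oddF_zero_hasDerivAt j) (oddF_integrable _ _)
    (((oddF_integrable 1 j).const_mul _).add (oddF_integrable 1 (j + 1))).neg x
  rw [integral_neg, integral_add ((oddF_integrable 1 j).const_mul _).integrableOn
    (oddF_integrable 1 (j + 1)).integrableOn, integral_const_mul] at h
  unfold oddPhi
  linarith

lemma oddPhi_one_zero (x : ℝ) : oddPhi 1 0 x = oddF 0 0 x := by
  have h := odd_ftc _ _ oddF_zero_zero_hasDerivAt (oddF_integrable _ _)
    (oddF_integrable 1 0).neg x
  rw [integral_neg] at h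
  unfold oddPhi
  linarith

lemma oddPhi_zero_zero : oddPhi 0 0 0 = Real.sqrt (Real.pi / 2) := by
  have h := integral_gaussian_Ioi (1 / 2)
  unfold oddPhi oddF
  simp only [pow_zero, one_mul, mul_one]
  rw [show (fun t : ℝ => Real.exp (-t ^ 2 / 2)) = fun t => Real.exp (-(1 / 2) * t ^ 2) by
    funext t; congr 1; ring, h]
  rw [show Real.pi / (1 / 2) = 2 ^ 2 * (Real.pi / 2) by ring, Real.sqrt_mul (by norm_num),
    Real.sqrt_sq (by norm_num)]
  ring

lemma gFun_eq_det (a n : ℕ) (t : Fin n → ℝ) :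
    gFun a t = Matrix.det (Matrix.of fun i j : Fin n => oddF a j (t i)) := by
  have h := Matrix.det_mul_column (fun i => t i ^ a * Real.exp (-t i ^ 2 / 2))
    (Matrix.vandermonde fun i => -t i ^ 2)
  have h2 : (Matrix.of fun i j : Fin n => oddF a j (t i)) = Matrix.of fun i j =>
      (t i ^ a * Real.exp (-t i ^ 2 / 2)) * (Matrix.vandermonde fun i => -t i ^ 2) i j := by
    ext i j; simp [oddF, Matrix.vandermonde]
  rw [h2, h, Matrix.det_vandermonde, gFun]
  congr 1
  rw [Finset.prod_comm' (t' := Finset.univ) (s' := fun j => Finset.Ioi j)]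
  · refine Finset.prod_congr rfl fun i _ => Finset.prod_congr rfl fun j _ => ?_
    ring
  · simp

lemma odd_integral_det (a n : ℕ) (I : Fin n → Set ℝ) :
    ∫ t in Set.univ.pi I, gFun a t =
      Matrix.det (Matrix.of fun i j : Fin n => ∫ x in I i, oddF a j x) := by
  simp_rw [gFun_eq_det]
  rw [volume_pi, Measure.restrict_pi_pi]
  rw [← Matrix.det_transpose]
  simp_rw [← Matrix.det_transpose (Matrix.of fun i j : Fin n => oddF a j _)]
  simp only [Matrix.det_apply', Matrix.transpose_apply, Matrix.of_apply]
  rw [integral_finsetSum]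
  · refine Finset.sum_congr rfl fun σ _ => ?_
    rw [integral_const_mul]
    congr 1
    exact integral_fintype_prod_eq_prod (fun i x => oddF a (σ i) x)
  · intro σ _
    apply Integrable.const_mul
    exact Integrable.fintype_prod (f := fun i x => oddF a (σ i) x)
      fun i => (oddF_integrable _ _).integrableOn

lemma odd_integral_phi (a n : ℕ) (S : Fin (n + 1) → ℝ)
    (hS : ∀ i : Fin n, S i.succ ≤ S i.castSucc) (I : Fin (n + 1) → Set ℝ)
    (h0 : I 0 = Set.Ici (S 0)) (h1 : ∀ i : Fin n, I i.succ = Set.Icc (S i.succ) (S i.castSucc)) :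
    ∫ t in Set.univ.pi I, gFun a t =
      Matrix.det (Matrix.of fun i j : Fin (n + 1) => oddPhi a j (S i)) := by
  rw [odd_integral_det]
  symm
  apply Matrix.det_eq_of_forall_row_eq_smul_add_pred (fun _ => 1)
  · intro j
    simp [h0, oddPhi, integral_Ici_eq_integral_Ioi]
  · intro i j
    simp only [Matrix.of_apply, h1, oddPhi, one_mul, integral_Icc_eq_integral_Ioc]
    rw [← setIntegral_union (Set.Ioc_disjoint_Ioi le_rfl) measurableSet_Ioi
      (oddF_integrable _ _).integrableOn (oddF_integrable _ _).integrableOn,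
      Set.Ioc_union_Ioi_eq_Ioi (hS i)]

lemma odd_det_one (n : ℕ) (S : Fin (n + 1) → ℝ) :
    Matrix.det (Matrix.of fun i j : Fin (n + 1) => oddPhi 1 j (S i)) = gFun 0 S := by
  rw [gFun_eq_det]
  apply Matrix.det_eq_of_forall_col_eq_smul_add_pred (fun j => -(2 * (((j : ℕ) : ℝ) + 1)))
  · intro i
    simp [oddPhi_one_zero]
  · intro i j
    simp [oddPhi_one_succ]

lemma odd_det_zero (n : ℕ) (s : Fin n → ℝ) :
    Matrix.det (Matrix.of fun i j : Fin (n + 1) =>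
      oddPhi 0 j ((Fin.snoc s 0 : Fin (n + 1) → ℝ) i)) = Real.sqrt (Real.pi / 2) * gFun 1 s := by
  have h : Matrix.det (Matrix.of fun i j : Fin (n + 1) =>
      oddPhi 0 j ((Fin.snoc s 0 : Fin (n + 1) → ℝ) i)) =
      Matrix.det (Matrix.of fun i j : Fin (n + 1) =>
        (Fin.cases (oddPhi 0 0 ((Fin.snoc s 0 : Fin (n + 1) → ℝ) i))
          (fun k : Fin n => -oddF 1 k ((Fin.snoc s 0 : Fin (n + 1) → ℝ) i)) j : ℝ)) := by
    apply Matrix.det_eq_of_forall_col_eq_smul_add_pred (fun j => -(2 * ((j : ℕ) : ℝ) + 1))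
    · intro i
      simp
    · intro i j
      simp [oddPhi_zero_succ]
  rw [h, Matrix.det_succ_row _ (Fin.last n), Fin.sum_univ_succ, Finset.sum_eq_zero]
  · have h3 : ((Matrix.of fun i j : Fin (n + 1) =>
        (Fin.cases (oddPhi 0 0 ((Fin.snoc s 0 : Fin (n + 1) → ℝ) i))
          (fun k : Fin n => -oddF 1 k ((Fin.snoc s 0 : Fin (n + 1) → ℝ) i)) j : ℝ)).submatrix
          (Fin.last n).succAbove (Fin.succAbove 0)) =
        -(Matrix.of fun i j : Fin n => oddF 1 j (s i)) := by
      ext i j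
      simp
    rw [h3, Matrix.det_neg, ← gFun_eq_det]
    simp only [Matrix.of_apply, Fin.snoc_last, Fin.cases_zero, oddPhi_zero_zero]
    simp only [Fin.val_last, Fin.val_zero, add_zero, Fintype.card_fin]
    have : ((-1 : ℝ) ^ n) * (-1) ^ n = 1 := by rw [← mul_pow]; simp
    linear_combination (Real.sqrt (Real.pi / 2) * gFun 1 s) * this
  · intro j _
    simp [oddF]

/-- Integrating `g_{1-μ}(t₁,…,t_m̂)` over the region where `t` interlaces with `s`
as `t₁ ≥ s₁ ≥ t₂ ≥ s₂ ≥ … ≥ t_m̂ ≥ s_m̂` (with `s_m̂ = 0` if `μ = 1`) gives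
`(π/2)^{μ/2} · g_μ(s₁,…,s_m)`. -/
theorem integrate_out_odd (m μ : ℕ) (hμ : μ = 0 ∨ μ = 1)
    (s : Fin m → ℝ) (hs_dec : ∀ i j : Fin m, i ≤ j → s j ≤ s i)
    (hs_nonneg : ∀ i, 0 ≤ s i) :
    (∫ t : Fin (m + μ) → ℝ in
        Set.univ.pi (fun i : Fin (m + μ) =>
          if h0 : (i : ℕ) = 0 then
            Set.Ici (if h : (i : ℕ) < m then s ⟨(i : ℕ), h⟩ else 0)
          else
            Set.Icc (if h : (i : ℕ) < m then s ⟨(i : ℕ), h⟩ else 0)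
              (s ⟨(i : ℕ) - 1, by omega⟩)),
        gFun (1 - μ) t) =
      (Real.pi / 2) ^ ((μ : ℝ) / 2) * gFun μ s := by
  rcases hμ with rfl | rfl
  · rcases m with _ | n
    · simp [gFun, integral_unique, Measure.real, volume_pi]
    · rw [odd_integral_phi (1 - 0) n s (fun i => hs_dec _ _ (Fin.castSucc_lt_succ).le)]
      · rw [odd_det_one]; simp
      · simp
      · intro i
        simp
        rfl
  · have hl : ∀ i : Fin (m + 1), (Fin.snoc s 0 : Fin (m + 1) → ℝ) i =
        if h : (i : ℕ) < m then s ⟨(i : ℕ), h⟩ else 0 := by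
      intro i
      simp [Fin.snoc]
      rfl
    rw [odd_integral_phi (1 - 1) m (Fin.snoc s 0)]
    · rw [odd_det_zero, Real.sqrt_eq_rpow]; simp
    · intro i
      rw [Fin.snoc_castSucc, hl]
      split_ifs with h
      · exact hs_dec _ _ (by simp [Fin.le_def])
      · exact hs_nonneg _
    · rw [hl]; simp
    · intro i
      rw [Fin.snoc_castSucc, hl]
      simp
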